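/- arXiv:1511.02235 — 3 statements merged into one kernel-verified Lean document; each statement's English description precedes it below -/
import Mathlib

section
/- For every d ≥ 0 and every 0-instance x ∈ {0,1}^(4^d) (i.e., NAND_{2d}(x) = 0), the effective resistance satisfies R_{s',t'}(G'_d(x)) ≤ 2^d. -/
open scoped ENNReal
open scoped Classical

namespace NandTree

/-- The bit-`b` half of an input of length `2^(m+1)`: `b = false` gives the first half,
`b = true` the second half (lexicographic indexing, first bit most significant). -/
def halfInput (m : ℕ) (b : Bool) (x : Fin (2^(m+1)) → Bool) : Fin (2^m) → Bool :=
  fun i => x ⟨(cond b 1 0) * 2^m + i.val, by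
    have h := i.isLt
    have h2 : (2:ℕ)^(m+1) = 2^m * 2 := pow_succ 2 m
    cases b <;> simp only [cond_true, cond_false] <;> omega⟩

/-- The value `NAND_ℓ(x)` of a depth-`ℓ` NAND-tree instance: internal nodes at even
distance from the leaves are OR gates, at odd distance AND gates. -/
def nand : (ℓ : ℕ) → (Fin (2^ℓ) → Bool) → Bool
  | 0, x => x ⟨0, by norm_num⟩
  | (ℓ+1), x =>
    if (ℓ+1) % 2 = 0 then
      nand ℓ (halfInput ℓ false x) || nand ℓ (halfInput ℓ true x)
    else
      nand ℓ (halfInput ℓ false x) && nand ℓ (halfInput ℓ true x)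

/-- Index of a leaf given by a root-to-leaf bit string (lexicographic, first bit most
significant). -/
def leafIdx (s : List Bool) : ℕ := s.foldl (fun n b => 2 * n + cond b 1 0) 0

/-- The value of the leaf reached by bit string `s` in instance `x`. -/
def leafVal (m : ℕ) (x : Fin (2^m) → Bool) (s : List Bool) : Bool :=
  if h : leafIdx s < 2^m then x ⟨leafIdx s, h⟩ else false

/-- Edges of the multigraph `G'_d`: `G'_0` has a single edge; each edge `e` of `G'_d` is
replaced by four edges `(e, c, b)` in `G'_{d+1}`, where `c` selects the side (`false`:
between `u'` and the middle vertex, `true`: between the middle vertex and `v'`) and `b`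
selects one of the two parallel edges on that side. -/
def Edg' : ℕ → Type
  | 0 => Unit
  | (d+1) => Edg' d × Bool × Bool

/-- Vertices of `G'_d`: `G'_0` has vertices `s' = false`, `t' = true`; `G'_{d+1}` has the
vertices of `G'_d` plus one new middle vertex for each edge of `G'_d`. -/
def Vtx' : ℕ → Type
  | 0 => Bool
  | (d+1) => Vtx' d ⊕ Edg' d

instance edg'Fintype : (d : ℕ) → Fintype (Edg' d)
  | 0 => inferInstanceAs (Fintype Unit)
  | (d+1) => letI := edg'Fintype d; inferInstanceAs (Fintype (Edg' d × Bool × Bool))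

instance edg'DecEq : (d : ℕ) → DecidableEq (Edg' d)
  | 0 => inferInstanceAs (DecidableEq Unit)
  | (d+1) => letI := edg'DecEq d; inferInstanceAs (DecidableEq (Edg' d × Bool × Bool))

instance vtx'DecEq : (d : ℕ) → DecidableEq (Vtx' d)
  | 0 => inferInstanceAs (DecidableEq Bool)
  | (d+1) => letI := edg'DecEq d; letI := vtx'DecEq d
             inferInstanceAs (DecidableEq (Vtx' d ⊕ Edg' d))

/-- The two endpoints of an edge of `G'_d`. -/
def ep' : (d : ℕ) → Edg' d → Bool → Vtx' d
  | 0, _, k => k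
  | (d+1), (e, c, _b), k =>
    match c, k with
    | false, false => Sum.inl (ep' d e false)
    | false, true  => Sum.inr e
    | true,  false => Sum.inr e
    | true,  true  => Sum.inl (ep' d e true)

/-- The vertex `s'` of `G'_d`. -/
def sVtx' : (d : ℕ) → Vtx' d
  | 0 => false
  | (d+1) => Sum.inl (sVtx' d)

/-- The vertex `t'` of `G'_d`. -/
def tVtx' : (d : ℕ) → Vtx' d
  | 0 => true
  | (d+1) => Sum.inl (tVtx' d)

/-- The label of an edge of `G'_d`: the edge of `G'_0` is labeled by the empty string,
and the four edges replacing an edge labeled `τ` are labeled `τ00`, `τ01` (the two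
parallel edges between `u'` and the middle vertex) and `τ10`, `τ11` (the two parallel
edges between the middle vertex and `v'`). -/
def elabel' : (d : ℕ) → Edg' d → List Bool
  | 0, _ => []
  | (d+1), (e, c, b) => elabel' d e ++ [c, b]

/-- The input bit of `x` associated with edge `e` of `G'_d`. -/
def edgeBit' (d : ℕ) (x : Fin (2^(2*d)) → Bool) (e : Edg' d) : Bool :=
  leafVal (2*d) x (elabel' d e)

/-- Two vertices are adjacent via a kept edge. -/
def adjE {V E : Type} (epf : E → Bool → V) (keep : E → Prop) (u v : V) : Prop :=
  ∃ e, keep e ∧ ((epf e false = u ∧ epf e true = v) ∨ (epf e false = v ∧ epf e true = u))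

/-- `a` and `b` are connected in the (multi)graph with endpoint map `epf`, restricted to
the edges satisfying `keep`. -/
def ConnectedIn {V E : Type} (epf : E → Bool → V) (keep : E → Prop) (a b : V) : Prop :=
  Relation.ReflTransGen (adjE epf keep) a b

/-- The net flow of `θ` out of vertex `v` (each edge oriented from its `false` endpoint
to its `true` endpoint; a function on oriented edges with `θ(rev e) = -θ(e)` is the same
data as a function on these chosen orientations). -/
noncomputable def netFlow {V E : Type} [Fintype E] (epf : E → Bool → V) (θ : E → ℝ)
    (v : V) : ℝ :=
  ∑ e, θ e * ((if epf e false = v then (1:ℝ) else 0) - (if epf e true = v then 1 else 0))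

/-- `θ` is a unit `s`-`t` flow supported on the kept edges: it vanishes on discarded
edges, has net outflow `1` at `s`, net inflow `1` at `t`, and zero net flow elsewhere. -/
def IsUnitFlow {V E : Type} [Fintype E] (epf : E → Bool → V) (keep : E → Prop)
    (s t : V) (θ : E → ℝ) : Prop :=
  (∀ e, ¬ keep e → θ e = 0) ∧
  (∀ v, netFlow epf θ v = (if v = s then (1:ℝ) else 0) - (if v = t then 1 else 0))

/-- The effective resistance between `s` and `t` in the (multi)graph given by the edges
satisfying `keep`: the least energy of a unit `s`-`t` flow if `s` and `t` are connected,
and `∞` otherwise. -/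
noncomputable def effRes {V E : Type} [Fintype E] (epf : E → Bool → V) (keep : E → Prop)
    (s t : V) : ℝ≥0∞ :=
  if ConnectedIn epf keep s t then
    ⨅ θ ∈ {θ : E → ℝ | IsUnitFlow epf keep s t θ}, ENNReal.ofReal (∑ e, (θ e)^2)
  else ⊤

/-- NAND tree evaluation on inputs indexed by bit strings. -/
def nandL : ℕ → (List Bool → Bool) → Bool
  | 0, f => f []
  | (l+1), f =>
    if (l+1) % 2 = 0 then
      nandL l (fun s => f (false :: s)) || nandL l (fun s => f (true :: s))
    else
      nandL l (fun s => f (false :: s)) && nandL l (fun s => f (true :: s))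

theorem nandL_congr (l : ℕ) : ∀ (f g : List Bool → Bool),
    (∀ s, s.length = l → f s = g s) → nandL l f = nandL l g := by
  induction l with
  | zero => intro f g h; exact h [] rfl
  | succ l ih =>
    intro f g h
    have h0 := ih (fun s => f (false :: s)) (fun s => g (false :: s))
      (fun s hs => h _ (by simp [hs]))
    have h1 := ih (fun s => f (true :: s)) (fun s => g (true :: s))
      (fun s hs => h _ (by simp [hs]))
    simp only [nandL, h0, h1]

theorem foldl_idx (s : List Bool) : ∀ n : ℕ,
    s.foldl (fun n b => 2 * n + cond b 1 0) n = n * 2 ^ s.length + leafIdx s := by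
  induction s with
  | nil => intro n; simp [leafIdx]
  | cons b s ih =>
    intro n
    have h1 := ih (2 * n + cond b 1 0)
    have h2 := ih (2 * 0 + cond b 1 0)
    simp only [leafIdx, List.foldl_cons, List.length_cons] at *
    rw [h1, h2]
    ring

theorem leafIdx_cons (b : Bool) (s : List Bool) :
    leafIdx (b :: s) = (cond b 1 0) * 2 ^ s.length + leafIdx s := by
  have := foldl_idx s (2 * 0 + cond b 1 0)
  simpa [leafIdx] using this

theorem leafIdx_lt (s : List Bool) : leafIdx s < 2 ^ s.length := by
  induction s with
  | nil => simp [leafIdx]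
  | cons b s ih =>
    rw [leafIdx_cons, List.length_cons, pow_succ]
    cases b <;> simp only [cond_true, cond_false] <;> omega

theorem leafVal_cons (l : ℕ) (x : Fin (2^(l+1)) → Bool) (b : Bool) (s : List Bool)
    (hs : s.length = l) : leafVal (l+1) x (b :: s) = leafVal l (halfInput l b x) s := by
  subst hs
  have h1 := leafIdx_lt s
  have h2 := leafIdx_lt (b :: s)
  rw [List.length_cons] at h2
  unfold leafVal
  rw [dif_pos h1, dif_pos h2]
  simp only [halfInput, leafIdx_cons]

theorem nand_eq_nandL (l : ℕ) : ∀ x : Fin (2^l) → Bool, nand l x = nandL l (leafVal l x) := by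
  induction l with
  | zero => intro x; simp [nand, nandL, leafVal, leafIdx]
  | succ l ih =>
    intro x
    have h : ∀ b, nandL l (fun s => leafVal (l+1) x (b :: s)) = nand l (halfInput l b x) := by
      intro b
      rw [ih]
      exact nandL_congr l _ _ (fun s hs => leafVal_cons l x b s hs)
    simp only [nandL, nand, h]

theorem nandL_add_two (l : ℕ) : ∀ f : List Bool → Bool,
    nandL (l+2) f = nandL l (fun s => (f (s ++ [false, false]) && f (s ++ [false, true])) ||
      (f (s ++ [true, false]) && f (s ++ [true, true]))) := by
  induction l with
  | zero => intro f; simp [nandL]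
  | succ l ih =>
    intro f
    have h1 : nandL (l + 1 + 2) f = if (l + 2 + 1) % 2 = 0 then
        nandL (l+2) (fun s => f (false :: s)) || nandL (l+2) (fun s => f (true :: s))
      else nandL (l+2) (fun s => f (false :: s)) && nandL (l+2) (fun s => f (true :: s)) := rfl
    rw [h1, ih, ih]
    have : (l + 2 + 1) % 2 = (l + 1) % 2 := by omega
    simp only [this, nandL, List.cons_append]

/-- The refined flow: on each side, route everything through one available edge. -/
noncomputable def refFlow (d : ℕ) (f : List Bool → Bool) (θ : Edg' d → ℝ) : Edg' (d+1) → ℝ :=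
  fun p : Edg' d × Bool × Bool =>
    if p.2.2 = f (elabel' d p.1 ++ [p.2.1, false]) then θ p.1 else 0

theorem sum_edg_succ (d : ℕ) (F : Edg' (d+1) → ℝ) :
    ∑ p, F p = ∑ e : Edg' d, ∑ c : Bool, ∑ b : Bool, F (e, c, b) := by
  have h : ∀ G : Edg' d × Bool × Bool → ℝ,
      ∑ p, G p = ∑ e : Edg' d, ∑ c : Bool, ∑ b : Bool, G (e, c, b) := by
    intro G
    simp only [Fintype.sum_prod_type]
  exact h F

theorem sum_edg_zero (F : Edg' 0 → ℝ) : ∑ p, F p = F (() : Unit) := by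
  have h : ∀ G : Unit → ℝ, ∑ p, G p = G () := by intro G; simp
  exact h F

theorem ind_congr {p q : Prop} {_ : Decidable p} {_ : Decidable q} (h : p ↔ q) :
    (if p then (1:ℝ) else 0) = if q then 1 else 0 := by
  by_cases hq : q
  · rw [if_pos hq, if_pos (h.2 hq)]
  · rw [if_neg hq, if_neg (fun hp => hq (h.1 hp))]

theorem sum_ref (d : ℕ) (f : List Bool → Bool) (θ : Edg' d → ℝ) (e : Edg' d) (c : Bool)
    (w : ℝ) (φ : ℝ → ℝ) (h0 : φ 0 = 0) :
    ∑ b : Bool, φ (refFlow d f θ (e, c, b)) * w = φ (θ e) * w := by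
  simp only [refFlow, Fintype.sum_bool]
  cases f (elabel' d e ++ [c, false]) <;> simp [h0]

theorem main_aux (d : ℕ) : ∀ f : List Bool → Bool, nandL (2*d) f = false →
    ConnectedIn (ep' d) (fun e => f (elabel' d e) = false) (sVtx' d) (tVtx' d) ∧
    ∃ θ, IsUnitFlow (ep' d) (fun e => f (elabel' d e) = false) (sVtx' d) (tVtx' d) θ ∧
      ∑ e, (θ e)^2 = 2^d := by
  induction d with
  | zero =>
    intro f hf
    have hf' : f [] = false := hf
    refine ⟨Relation.ReflTransGen.single ⟨(), hf', Or.inl ⟨rfl, rfl⟩⟩, fun _ => 1, ⟨?_, ?_⟩, ?_⟩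
    · intro e he; exact absurd hf' he
    · intro v
      unfold netFlow
      rw [sum_edg_zero, one_mul]
      exact congrArg₂ (· - ·) (ind_congr eq_comm) (ind_congr eq_comm)
    · have : ∑ e : Edg' 0, (1:ℝ)^2 = ∑ e : Unit, (1:ℝ)^2 := rfl
      rw [this]; simp
  | succ d ih =>
    intro f hf
    rw [show 2 * (d+1) = 2*d+2 by ring, nandL_add_two] at hf
    obtain ⟨hc, θ, ⟨hk, hn⟩, hE⟩ := ih _ hf
    have key : ∀ e : Edg' d, ((f (elabel' d e ++ [false, false]) && f (elabel' d e ++ [false, true])) ||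
      (f (elabel' d e ++ [true, false]) && f (elabel' d e ++ [true, true]))) = false →
      ∀ c, f (elabel' d e ++ [c, f (elabel' d e ++ [c, false])]) = false := by
      intro e he c
      rw [Bool.or_eq_false_iff] at he
      cases c
      · cases h : f (elabel' d e ++ [false, false])
        · exact h
        · simpa [h] using he.1
      · cases h : f (elabel' d e ++ [true, false])
        · exact h
        · simpa [h] using he.2
    refine ⟨?_, refFlow d f θ, ⟨?_, ?_⟩, ?_⟩
    · refine Relation.ReflTransGen.trans_induction_on (motive := fun {a b} _ =>
        ConnectedIn (ep' (d+1)) (fun e => f (elabel' (d+1) e) = false)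
          (Sum.inl a : Vtx' d ⊕ Edg' d) (Sum.inl b : Vtx' d ⊕ Edg' d)) hc ?_ ?_ ?_
      · intro a; exact Relation.ReflTransGen.refl
      · rintro a b ⟨e, he, h⟩
        have k0 := key e he false
        have k1 := key e he true
        rcases h with ⟨rfl, rfl⟩ | ⟨rfl, rfl⟩
        · refine Relation.ReflTransGen.head (b := (Sum.inr e : Vtx' d ⊕ Edg' d))
            ⟨(e, false, _), k0, Or.inl ⟨rfl, rfl⟩⟩ (Relation.ReflTransGen.single
            ⟨(e, true, _), k1, Or.inl ⟨rfl, rfl⟩⟩)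
        · refine Relation.ReflTransGen.head (b := (Sum.inr e : Vtx' d ⊕ Edg' d))
            ⟨(e, true, _), k1, Or.inr ⟨rfl, rfl⟩⟩ (Relation.ReflTransGen.single
            ⟨(e, false, _), k0, Or.inr ⟨rfl, rfl⟩⟩)
      · intro a b c _ _ h1 h2; exact Relation.ReflTransGen.trans h1 h2
    · rintro ⟨e, c, b⟩ hne
      simp only [refFlow]
      split_ifs with hb
      · apply hk
        intro he
        apply hne
        have := key e he c
        rw [← hb] at this
        exact this
      · rfl
    · intro v
      have h1 : netFlow (ep' (d+1)) (refFlow d f θ) v = ∑ e : Edg' d, θ e *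
          (((if (Sum.inl (ep' d e false) : Vtx' d ⊕ Edg' d) = v then (1:ℝ) else 0) -
            (if (Sum.inr e : Vtx' d ⊕ Edg' d) = v then (1:ℝ) else 0)) +
           ((if (Sum.inr e : Vtx' d ⊕ Edg' d) = v then (1:ℝ) else 0) -
            (if (Sum.inl (ep' d e true) : Vtx' d ⊕ Edg' d) = v then (1:ℝ) else 0))) := by
        unfold netFlow
        rw [sum_edg_succ]
        refine Finset.sum_congr rfl fun e _ => ?_
        rw [Fintype.sum_bool, mul_add, add_comm]
        exact congrArg₂ (· + ·) (sum_ref d f θ e false _ id rfl) (sum_ref d f θ e true _ id rfl)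
      rw [h1]
      simp only [sub_add_sub_cancel]
      rcases v with v | e0
      · have h2 := hn v
        unfold netFlow at h2
        have h3 : ∀ a b : Vtx' d, (Sum.inl a : Vtx' d ⊕ Edg' d) = Sum.inl b ↔ a = b :=
          fun a b => Sum.inl_injective.eq_iff
        refine Eq.trans (Finset.sum_congr rfl fun e _ => congrArg (θ e * ·)
          (congrArg₂ (· - ·) (ind_congr (h3 _ _)) (ind_congr (h3 _ _)))) (h2.trans ?_)
        exact congrArg₂ (· - ·) (ind_congr (h3 _ _).symm) (ind_congr (h3 _ _).symm)
      · simp [sVtx', tVtx']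
    · rw [sum_edg_succ, pow_succ, ← hE, Finset.sum_mul]
      refine Finset.sum_congr rfl fun e _ => ?_
      have := fun c => sum_ref d f θ e c 1 (fun t => t^2) (by simp)
      simp only [mul_one] at this
      simp only [this, Fintype.sum_bool]
      ring

/-- For every `0`-instance `x`, `R_{s',t'}(G'_d(x)) ≤ 2^d`. -/
theorem effRes_le_of_zero_instance (d : ℕ) (x : Fin (2^(2*d)) → Bool)
    (h : nand (2*d) x = false) :
    effRes (ep' d) (fun e => edgeBit' d x e = false) (sVtx' d) (tVtx' d) ≤ 2^d := by
  rw [nand_eq_nandL] at h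
  obtain ⟨hc, θ, hθ, hE⟩ := main_aux d _ h
  have hc' : ConnectedIn (ep' d) (fun e => edgeBit' d x e = false) (sVtx' d) (tVtx' d) := hc
  unfold effRes
  rw [if_pos hc']
  refine (iInf₂_le θ hθ).trans ?_
  rw [hE, ENNReal.ofReal_pow (by norm_num)]
  simp

end NandTree
end

section
/- For every d ≥ 0 and every 0-instance x ∈ {0,1}^(4^d) (i.e., NAND_{2d}(x) = 0), the negative witness size of x in the span program P_{G_d} equals twice the effective resistance in the dual-family graph: w_-(x, P_{G_d}) = 2 R_{s',t'}(G'_d(x)). -/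
open scoped ENNReal
open scoped Classical

namespace NandTree

/-- Edges of the graph `G_d`: `G_0` has a single edge; each edge `e` of `G_d` is replaced
by four edges `(e, b, c)` in `G_{d+1}`, where `b` selects one of the two length-2 paths
and `c` selects the side (`false`: the `u`-side edge, `true`: the `v`-side edge). -/
def Edg : ℕ → Type
  | 0 => Unit
  | (d+1) => Edg d × Bool × Bool

/-- Vertices of `G_d`: `G_0` has vertices `s = false`, `t = true`; `G_{d+1}` has the
vertices of `G_d` plus one new middle vertex `(e, b)` for each edge `e` of `G_d` and
each of the two length-2 paths `b` replacing it. -/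
def Vtx : ℕ → Type
  | 0 => Bool
  | (d+1) => Vtx d ⊕ (Edg d × Bool)

instance edgFintype : (d : ℕ) → Fintype (Edg d)
  | 0 => inferInstanceAs (Fintype Unit)
  | (d+1) => letI := edgFintype d; inferInstanceAs (Fintype (Edg d × Bool × Bool))

instance edgDecEq : (d : ℕ) → DecidableEq (Edg d)
  | 0 => inferInstanceAs (DecidableEq Unit)
  | (d+1) => letI := edgDecEq d; inferInstanceAs (DecidableEq (Edg d × Bool × Bool))

instance vtxDecEq : (d : ℕ) → DecidableEq (Vtx d)
  | 0 => inferInstanceAs (DecidableEq Bool)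
  | (d+1) => letI := edgDecEq d; letI := vtxDecEq d
             inferInstanceAs (DecidableEq (Vtx d ⊕ (Edg d × Bool)))

/-- The two endpoints of an edge of `G_d`: `ep d e false` is the `u`-end and
`ep d e true` is the `v`-end. -/
def ep : (d : ℕ) → Edg d → Bool → Vtx d
  | 0, _, k => k
  | (d+1), (e, b, c), k =>
    match c, k with
    | false, false => Sum.inl (ep d e false)
    | false, true  => Sum.inr (e, b)
    | true,  false => Sum.inr (e, b)
    | true,  true  => Sum.inl (ep d e true)

/-- The vertex `s` of `G_d`. -/
def sVtx : (d : ℕ) → Vtx d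
  | 0 => false
  | (d+1) => Sum.inl (sVtx d)

/-- The vertex `t` of `G_d`. -/
def tVtx : (d : ℕ) → Vtx d
  | 0 => true
  | (d+1) => Sum.inl (tVtx d)

/-- The label of an edge of `G_d`, a bit string of length `2d`: the edge of `G_0` is
labeled by the empty string, and the four edges replacing an edge labeled `τ` are
labeled `τ00`, `τ01` (the two edges of the first path, `u`- and `v`-side) and
`τ10`, `τ11` (the two edges of the second path). -/
def elabel : (d : ℕ) → Edg d → List Bool
  | 0, _ => []
  | (d+1), (e, b, c) => elabel d e ++ [b, c]

/-- The input bit of `x` associated with edge `e` of `G_d` (bits of `x` indexed by the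
edge labels in lexicographic order). -/
def edgeBit (d : ℕ) (x : Fin (2^(2*d)) → Bool) (e : Edg d) : Bool :=
  leafVal (2*d) x (elabel d e)

/-- The negative witness size `w₋(x, P_{G_d})` of the span program `P_{G_d}`: the least
value of `‖ω ∘ A‖² = Σ_{(e,o)} (ω(ep e o) - ω(ep e (!o)))²` over linear functionals
`ω : V(G_d) → ℝ` vanishing on `A(H(x))` (i.e. `ω(u) - ω(v) = 0` across every available
directed edge) with `ω(|s⟩ - |t⟩) = 1`; the infimum over the empty set being `⊤ = ∞`
when no witness exists. -/
noncomputable def negWit (d : ℕ) (x : Fin (2^(2*d)) → Bool) : ℝ≥0∞ :=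
  ⨅ ω ∈ {ω : Vtx d → ℝ |
      (∀ p : Edg d × Bool, edgeBit d x p.1 = true →
        ω (ep d p.1 p.2) - ω (ep d p.1 (!p.2)) = 0) ∧
      ω (sVtx d) - ω (tVtx d) = 1},
    ENNReal.ofReal (∑ p : Edg d × Bool, (ω (ep d p.1 p.2) - ω (ep d p.1 (!p.2)))^2)

/-- The identification of the edges of `G_d` with the edges of the dual `G'_d`. -/
def dualEdge : (d : ℕ) → Edg d ≃ Edg' d
  | 0 => Equiv.refl Unit
  | (d+1) => Equiv.prodCongr (dualEdge d) (Equiv.refl (Bool × Bool))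

theorem elabel_dual : ∀ (d : ℕ) (e : Edg d), elabel' d (dualEdge d e) = elabel d e
  | 0, _ => rfl
  | (d+1), (e, b, c) => by
    change elabel' d (dualEdge d e) ++ [b, c] = elabel d e ++ [b, c]
    rw [elabel_dual d e]

theorem edgeBit_dual (d : ℕ) (x : Fin (2^(2*d)) → Bool) (e : Edg d) :
    edgeBit' d x (dualEdge d e) = edgeBit d x e := by
  unfold edgeBit' edgeBit
  rw [elabel_dual]

/-- Recursive form of the flow / potential-difference constraints. -/
def Cons : (d : ℕ) → (Edg' d → ℝ) → Prop
  | 0, θ => θ () = 1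
  | (d+1), θ => ∃ ψ : Edg' d → ℝ, Cons d ψ ∧
      ∀ e b, θ (e, b, false) + θ (e, b, true) = ψ e

/-- Endpoints of the graph where every edge is replaced by two parallel length-2 paths
through a common middle vertex. -/
def subEp {V E : Type} (epf : E → Bool → V) (p : E × Bool × Bool) (k : Bool) : V ⊕ E :=
  match p.2.1, k with
  | false, false => Sum.inl (epf p.1 false)
  | false, true  => Sum.inr p.1
  | true,  false => Sum.inr p.1
  | true,  true  => Sum.inl (epf p.1 true)

theorem ep'_succ (d : ℕ) : ep' (d+1) = subEp (ep' d) := by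
  funext p k
  obtain ⟨e, c, b⟩ := p
  cases c <;> cases k <;> rfl

theorem netFlow_succ (d : ℕ) (θ : Edg' (d+1) → ℝ) (v : Vtx' (d+1)) :
    netFlow (ep' (d+1)) θ v
      = netFlow (V := Vtx' d ⊕ Edg' d) (E := Edg' d × Bool × Bool) (subEp (ep' d)) θ v :=
  congrArg (fun f => netFlow f θ v) (ep'_succ d)

theorem sub_inr {V E : Type} [Fintype E] (epf : E → Bool → V) (θ : E × Bool × Bool → ℝ) (e : E) :
    netFlow (subEp epf) θ (Sum.inr e)
      = (θ (e, true, true) + θ (e, true, false)) - (θ (e, false, true) + θ (e, false, false)) := by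
  unfold netFlow
  rw [Fintype.sum_prod_type]
  simp only [Fintype.sum_prod_type, Fintype.sum_bool, subEp, reduceCtorEq, if_false,
    Sum.inr.injEq]
  rw [Finset.sum_eq_single e]
  · simp only [if_true]; ring
  · intro f _ hf
    simp [hf]
  · intro h; exact absurd (Finset.mem_univ e) h

theorem sub_inl {V E : Type} [Fintype E] (epf : E → Bool → V) (θ : E × Bool × Bool → ℝ)
    (θ' : E → ℝ) (h : ∀ e b, θ (e, b, false) + θ (e, b, true) = θ' e) (v : V) :
    netFlow (subEp epf) θ (Sum.inl v) = netFlow epf θ' v := by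
  unfold netFlow
  rw [Fintype.sum_prod_type]
  simp only [Fintype.sum_prod_type, Fintype.sum_bool, subEp, reduceCtorEq, if_false,
    Sum.inl.injEq]
  refine Finset.sum_congr rfl fun f _ => ?_
  have e1 := h f false
  have e2 := h f true
  linear_combination (if epf f false = v then (1:ℝ) else 0) * e1
    - (if epf f true = v then (1:ℝ) else 0) * e2

/-- The demand of a unit flow. -/
noncomputable def dem {V : Type} (s t v : V) : ℝ :=
  (if v = s then (1:ℝ) else 0) - (if v = t then 1 else 0)

theorem dem_inl {V E : Type} (s t v : V) :
    dem (Sum.inl s : V ⊕ E) (Sum.inl t) (Sum.inl v) = dem s t v := by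
  simp only [dem, Sum.inl.injEq]

theorem dem_inr {V E : Type} (s t : V) (e : E) :
    dem (Sum.inl s : V ⊕ E) (Sum.inl t) (Sum.inr e) = 0 := by
  simp [dem]

theorem base_flow (θ : Unit → ℝ) :
    (∀ v : Bool, netFlow (fun (_ : Unit) k => k) θ v = dem false true v) ↔ θ () = 1 := by
  unfold netFlow dem
  simp only [Fintype.sum_unique]
  constructor
  · intro h
    simpa using h false
  · intro h v
    have h' : θ default = 1 := h
    cases v <;> simp [h']

theorem flow_iff : ∀ (d : ℕ) (θ : Edg' d → ℝ),
    (∀ v, netFlow (ep' d) θ v = dem (sVtx' d) (tVtx' d) v) ↔ Cons d θ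
  | 0, θ => base_flow θ
  | (d+1), θ => by
    constructor
    · intro h
      have hc : ∀ e b, θ (e, b, false) + θ (e, b, true)
          = θ (e, false, false) + θ (e, false, true) := by
        intro e b
        have h0 := ((sub_inr (ep' d) θ e).symm.trans
          ((netFlow_succ d θ (Sum.inr e)).symm.trans (h (Sum.inr e)))).trans
          (dem_inr (sVtx' d) (tVtx' d) e)
        cases b
        · rfl
        · linarith
      refine ⟨fun e => θ (e, false, false) + θ (e, false, true), (flow_iff d _).1 ?_, hc⟩
      intro v
      exact ((sub_inl (ep' d) θ _ hc v).symm.trans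
          ((netFlow_succ d θ (Sum.inl v)).symm.trans (h (Sum.inl v)))).trans
          (dem_inl (E := Edg' d) (sVtx' d) (tVtx' d) v)
    · rintro ⟨θ', h', hc⟩ v
      refine (netFlow_succ d θ v).trans ?_
      rcases v with v | e
      · exact ((sub_inl (ep' d) θ _ hc v).trans ((flow_iff d θ').2 h' v)).trans
          (dem_inl (E := Edg' d) (sVtx' d) (tVtx' d) v).symm
      · refine ((sub_inr (ep' d) θ e).trans ?_).trans (dem_inr (sVtx' d) (tVtx' d) e).symm
        have h1 := hc e false
        have h2 := hc e true
        linarith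

theorem pot_cons : ∀ (d : ℕ) (θ : Edg' d → ℝ) (ω : Vtx d → ℝ),
    ω (sVtx d) - ω (tVtx d) = 1 →
    (∀ e, θ (dualEdge d e) = ω (ep d e false) - ω (ep d e true)) → Cons d θ
  | 0, θ, ω, h1, h2 => by
    change θ () = 1
    rw [← h1]
    exact h2 ()
  | (d+1), θ, ω, h1, h2 => by
    let ω' : Vtx d → ℝ := fun v => ω (Sum.inl v)
    refine ⟨fun e => ω' (ep d ((dualEdge d).symm e) false)
      - ω' (ep d ((dualEdge d).symm e) true), pot_cons d _ ω' h1 ?_, ?_⟩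
    · intro e
      simp
    · intro e b
      obtain ⟨e, rfl⟩ := (dualEdge d).surjective e
      have a1 : θ (dualEdge d e, b, false) = ω (Sum.inl (ep d e false)) - ω (Sum.inr (e, b)) :=
        h2 (e, b, false)
      have a2 : θ (dualEdge d e, b, true) = ω (Sum.inr (e, b)) - ω (Sum.inl (ep d e true)) :=
        h2 (e, b, true)
      have a3 : (dualEdge d).symm (dualEdge d e) = e := Equiv.symm_apply_apply _ _
      have a4 : ω' (ep d e false) = ω (Sum.inl (ep d e false)) := rfl
      have a5 : ω' (ep d e true) = ω (Sum.inl (ep d e true)) := rfl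
      change _ = ω' (ep d ((dualEdge d).symm (dualEdge d e)) false)
        - ω' (ep d ((dualEdge d).symm (dualEdge d e)) true)
      rw [a3]
      linarith

theorem cons_pot : ∀ (d : ℕ) (θ : Edg' d → ℝ), Cons d θ →
    ∃ ω : Vtx d → ℝ, ω (sVtx d) - ω (tVtx d) = 1 ∧
      ∀ e, θ (dualEdge d e) = ω (ep d e false) - ω (ep d e true)
  | 0, θ, h => by
    let ω : Bool → ℝ := fun b => cond b 0 1
    have h : θ () = 1 := h
    have hω : ω false - ω true = 1 := by simp [ω]
    exact ⟨ω, hω, fun e => h.trans hω.symm⟩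
  | (d+1), θ, ⟨θ', h', hc⟩ => by
    obtain ⟨ω', hst, hω⟩ := cons_pot d θ' h'
    let ω : Vtx d ⊕ (Edg d × Bool) → ℝ := Sum.elim ω' (fun p =>
      ω' (ep d p.1 false) - θ (dualEdge d p.1, p.2, false))
    refine ⟨ω, hst, ?_⟩
    rintro ⟨e, b, c⟩
    cases c
    · change θ (dualEdge d e, b, false) = ω' (ep d e false)
        - (ω' (ep d e false) - θ (dualEdge d e, b, false))
      ring
    · change θ (dualEdge d e, b, true) = (ω' (ep d e false) - θ (dualEdge d e, b, false))
        - ω' (ep d e true)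
      have h1 := hc (dualEdge d e) b
      have h2 := hω e
      linarith

theorem finite_vtx' : ∀ d : ℕ, Finite (Vtx' d)
  | 0 => inferInstanceAs (Finite Bool)
  | (d+1) => by
    have := finite_vtx' d
    exact inferInstanceAs (Finite (Vtx' d ⊕ Edg' d))

/-- A unit flow supported on the kept edges forces connectivity. -/
theorem connected_of_flow {V E : Type} [Finite V] [Fintype E] (epf : E → Bool → V)
    (keep : E → Prop) (s t : V) (θ : E → ℝ) (h : IsUnitFlow epf keep s t θ) :
    ConnectedIn epf keep s t := by
  have := Fintype.ofFinite V
  by_contra hn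
  obtain ⟨h1, h2⟩ := h
  let χ : V → ℝ := fun v => if ConnectedIn epf keep s v then 1 else 0
  have hs : χ s = 1 := if_pos Relation.ReflTransGen.refl
  have ht : χ t = 0 := if_neg hn
  have key : ∑ v, χ v * netFlow epf θ v = 1 := by
    simp only [h2, mul_sub, Finset.sum_sub_distrib, mul_ite, mul_one, mul_zero,
      Finset.sum_ite_eq', Finset.mem_univ, if_true, hs, ht, sub_zero]
  have key2 : ∑ v, χ v * netFlow epf θ v = ∑ e, θ e * (χ (epf e false) - χ (epf e true)) := by
    unfold netFlow
    simp only [Finset.mul_sum]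
    rw [Finset.sum_comm]
    refine Finset.sum_congr rfl fun e _ => ?_
    have : ∀ v, χ v * (θ e * ((if epf e false = v then (1:ℝ) else 0)
        - (if epf e true = v then 1 else 0)))
        = θ e * ((if epf e false = v then χ v else 0) - (if epf e true = v then χ v else 0)) := by
      intro v; split_ifs <;> ring
    simp only [this, ← Finset.mul_sum, Finset.sum_sub_distrib, Finset.sum_ite_eq,
      Finset.mem_univ, if_true]
  rw [key2] at key
  have : ∑ e, θ e * (χ (epf e false) - χ (epf e true)) = 0 := by
    refine Finset.sum_eq_zero fun e _ => ?_
    by_cases hk : keep e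
    · have : χ (epf e false) = χ (epf e true) := by
        have : ConnectedIn epf keep s (epf e false) ↔ ConnectedIn epf keep s (epf e true) :=
          ⟨fun h => h.tail ⟨e, hk, Or.inl ⟨rfl, rfl⟩⟩, fun h => h.tail ⟨e, hk, Or.inr ⟨rfl, rfl⟩⟩⟩
        simp only [χ, this]
      rw [this, sub_self, mul_zero]
    · rw [h1 e hk, zero_mul]
  rw [this] at key
  exact zero_ne_one key

theorem effRes_eq {V E : Type} [Finite V] [Fintype E] (epf : E → Bool → V)
    (keep : E → Prop) (s t : V) : effRes epf keep s t =
    ⨅ θ ∈ {θ : E → ℝ | IsUnitFlow epf keep s t θ}, ENNReal.ofReal (∑ e, (θ e)^2) := by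
  unfold effRes
  split_ifs with h
  · rfl
  · symm
    simp only [iInf_eq_top]
    intro θ hθ
    exact absurd (connected_of_flow epf keep s t θ hθ) h

theorem energy_eq (d : ℕ) (θ : Edg' d → ℝ) (ω : Vtx d → ℝ)
    (h : ∀ e, θ (dualEdge d e) = ω (ep d e false) - ω (ep d e true)) :
    ENNReal.ofReal (∑ p : Edg d × Bool, (ω (ep d p.1 p.2) - ω (ep d p.1 (!p.2)))^2)
      = 2 * ENNReal.ofReal (∑ e, (θ e)^2) := by
  have h2 : (2 : ℝ≥0∞) = ENNReal.ofReal 2 := by simp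
  rw [h2, ← ENNReal.ofReal_mul (by norm_num)]
  congr 1
  rw [Fintype.sum_prod_type, ← Equiv.sum_comp (dualEdge d), Finset.mul_sum]
  refine Finset.sum_congr rfl fun e _ => ?_
  rw [Fintype.sum_bool, h e]
  simp only [Bool.not_true, Bool.not_false]
  ring

/-- For every `0`-instance `x`,
`w₋(x, P_{G_d}) = 2 R_{s',t'}(G'_d(x))`. -/
theorem negWit_eq_two_effRes' (d : ℕ) (x : Fin (2^(2*d)) → Bool)
    (h : nand (2*d) x = false) :
    negWit d x
      = 2 * effRes (ep' d) (fun e => edgeBit' d x e = false) (sVtx' d) (tVtx' d) := by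
  have := finite_vtx' d
  rw [effRes_eq]
  rw [ENNReal.mul_iInf_of_ne (by norm_num) (by norm_num)]
  simp_rw [ENNReal.mul_iInf_of_ne (two_ne_zero) (ENNReal.ofNat_ne_top)]
  unfold negWit
  apply le_antisymm
  · refine le_iInf₂ fun θ hθ => ?_
    obtain ⟨ω, h1, h2⟩ := cons_pot d θ ((flow_iff d θ).1 hθ.2)
    refine (iInf₂_le ω ⟨?_, h1⟩).trans (energy_eq d θ ω h2).le
    rintro ⟨e, b⟩ he
    have h0 : ω (ep d e false) - ω (ep d e true) = 0 := by
      rw [← h2 e]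
      refine hθ.1 _ ?_
      beta_reduce
      rw [edgeBit_dual]
      simpa using he
    cases b
    · exact h0
    · change ω (ep d e true) - ω (ep d e false) = 0
      linarith
  · refine le_iInf₂ fun ω hω => ?_
    let θ : Edg' d → ℝ := fun e =>
      ω (ep d ((dualEdge d).symm e) false) - ω (ep d ((dualEdge d).symm e) true)
    have h2 : ∀ e, θ (dualEdge d e) = ω (ep d e false) - ω (ep d e true) := by
      intro e; simp [θ]
    refine (iInf₂_le θ ⟨?_, (flow_iff d θ).2 (pot_cons d θ ω hω.2 h2)⟩).trans
      (energy_eq d θ ω h2).ge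
    intro e he
    obtain ⟨e, rfl⟩ := (dualEdge d).surjective e
    beta_reduce at he
    rw [edgeBit_dual] at he
    rw [h2]
    exact hω.1 (e, false) (by simpa using he)

end NandTree
end

section
/- For every d ≥ 0 and every x ∈ {0,1}^(4^d), the approximate positive witness size of x in the span program P_{G_d} satisfies w̃_+(x, P_{G_d}) ≤ 2^(d+1). -/
open scoped ENNReal
open scoped Classical

namespace NandTree

/-- `w` satisfies `A w = |s⟩ - |t⟩` in the span program `P_{G_d}`, where
`A |(e,o)⟩ = |ep e o⟩ - |ep e (!o)⟩` on the directed edges of `G_d`. -/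
def IsTauWitness (d : ℕ) (w : Edg d × Bool → ℝ) : Prop :=
  ∀ v : Vtx d,
    (∑ p : Edg d × Bool, w p *
      ((if ep d p.1 p.2 = v then (1:ℝ) else 0) - (if ep d p.1 (!p.2) = v then 1 else 0)))
    = (if v = sVtx d then (1:ℝ) else 0) - (if v = tVtx d then 1 else 0)

/-- The positive error `e₊(x)` of `x` in `P_{G_d}`: the least squared norm of
`Π_{H(x)^⊥} w` (the part of `w` on directed edges unavailable for `x`) over all `w` with
`A w = |s⟩ - |t⟩`. -/
noncomputable def posErr (d : ℕ) (x : Fin (2^(2*d)) → Bool) : ℝ :=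
  sInf {r : ℝ | ∃ w : Edg d × Bool → ℝ, IsTauWitness d w ∧
    r = ∑ p : Edg d × Bool, (if edgeBit d x p.1 = true then 0 else (w p)^2)}

/-- The approximate positive witness size `w̃₊(x, P_{G_d})`: the least `‖w‖²` over all
`w` with `A w = |s⟩ - |t⟩` achieving the positive error `e₊(x)`. -/
noncomputable def approxPosWit (d : ℕ) (x : Fin (2^(2*d)) → Bool) : ℝ :=
  sInf {r : ℝ | ∃ w : Edg d × Bool → ℝ, IsTauWitness d w ∧
    (∑ p : Edg d × Bool, (if edgeBit d x p.1 = true then 0 else (w p)^2)) = posErr d x ∧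
    r = ∑ p : Edg d × Bool, (w p)^2}

/-- Net unit flows from `s` to `t` on `G_d`. -/
def IsFlow (d : ℕ) (f : Edg d → ℝ) : Prop :=
  ∀ v : Vtx d,
    (∑ e : Edg d, f e *
      ((if ep d e false = v then (1:ℝ) else 0) - (if ep d e true = v then 1 else 0)))
    = (if v = sVtx d then (1:ℝ) else 0) - (if v = tVtx d then 1 else 0)

/-- An old vertex, seen in `G_{d+1}`. -/
def vl {d : ℕ} (v : Vtx d) : Vtx (d+1) := Sum.inl v

/-- A new middle vertex of `G_{d+1}`. -/
def vr {d : ℕ} (p : Edg d × Bool) : Vtx (d+1) := Sum.inr p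

theorem sum_edg_succ_s16 (d : ℕ) (F : Edg (d+1) → ℝ) :
    ∑ p : Edg (d+1), F p = ∑ e : Edg d, (F (e, false, false) + F (e, false, true)
      + F (e, true, false) + F (e, true, true)) := by
  have h : ∀ G : Edg d × Bool × Bool → ℝ, ∑ p, G p = ∑ e : Edg d, (G (e, false, false)
      + G (e, false, true) + G (e, true, false) + G (e, true, true)) := by
    intro G
    rw [Fintype.sum_prod_type]
    refine Finset.sum_congr rfl fun e _ => ?_
    simp only [Fintype.sum_prod_type, Fintype.sum_bool]
    ring
  exact h F

theorem flow_inl (d : ℕ) (g : Edg (d+1) → ℝ) (v : Vtx d) :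
    (∑ p : Edg (d+1), g p * ((if ep (d+1) p false = vl v then (1:ℝ) else 0)
      - (if ep (d+1) p true = vl v then 1 else 0)))
    = ∑ e : Edg d, ((g (e, false, false) + g (e, true, false))
        * (if ep d e false = v then (1:ℝ) else 0)
      - (g (e, false, true) + g (e, true, true)) * (if ep d e true = v then 1 else 0)) := by
  rw [sum_edg_succ_s16]
  refine Finset.sum_congr rfl fun e _ => ?_
  have h1 : ∀ b k, ((ep (d+1) (e, b, !k) k : Vtx (d+1)) = vl v) = False := by
    intro b k
    cases k <;> exact eq_false (fun h => Sum.inr_ne_inl h)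
  have h2 : ∀ b k, ((ep (d+1) (e, b, k) k : Vtx (d+1)) = vl v) = (ep d e k = v) := by
    intro b k
    cases k <;> exact propext Sum.inl.inj_iff
  have a1 := h1 false false
  have a2 := h1 false true
  have a3 := h1 true false
  have a4 := h1 true true
  simp only [Bool.not_true, Bool.not_false] at a1 a2 a3 a4
  simp only [a1, a2, a3, a4, h2, if_false]
  ring

theorem flow_inr (d : ℕ) (g : Edg (d+1) → ℝ) (e : Edg d) (b : Bool) :
    (∑ p : Edg (d+1), g p * ((if ep (d+1) p false = vr (e, b) then (1:ℝ) else 0)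
      - (if ep (d+1) p true = vr (e, b) then 1 else 0)))
    = g (e, b, true) - g (e, b, false) := by
  rw [sum_edg_succ_s16, Finset.sum_eq_single e]
  · have h1 : ∀ b' k, ((ep (d+1) (e, b', k) k : Vtx (d+1)) = vr (e, b)) = False := by
      intro b' k
      cases k <;> exact eq_false (fun h => Sum.inl_ne_inr h)
    have h2 : ∀ b' k, ((ep (d+1) (e, b', !k) k : Vtx (d+1)) = vr (e, b)) = (b' = b) := by
      intro b' k
      have : ((Sum.inr (e, b') : Vtx d ⊕ (Edg d × Bool)) = Sum.inr (e, b)) = (b' = b) := by simp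
      cases k <;> exact this
    have a1 := fun b => h2 b false
    have a2 := fun b => h2 b true
    simp only [Bool.not_true, Bool.not_false] at a1 a2
    simp only [a1, a2, h1, if_false]
    cases b <;> simp <;> ring
  · intro e' _ hne
    have h1 : ∀ b' c k, ((ep (d+1) (e', b', c) k : Vtx (d+1)) = vr (e, b)) = False := by
      intro b' c k
      have : ¬ ((Sum.inr (e', b') : Vtx d ⊕ (Edg d × Bool)) = Sum.inr (e, b)) := by
        simp [hne]
      cases k <;> cases c <;>
        first | exact eq_false this | exact eq_false (fun h => Sum.inl_ne_inr h)
    simp only [h1, if_false]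
    ring
  · intro h
    exact absurd (Finset.mem_univ _) h

theorem ind_inl (d : ℕ) (v : Vtx d) :
    ((if vl v = sVtx (d+1) then (1:ℝ) else 0)
      - (if vl v = tVtx (d+1) then 1 else 0))
    = (if v = sVtx d then (1:ℝ) else 0) - (if v = tVtx d then 1 else 0) := by
  have h1 : (vl v = sVtx (d+1)) = (v = sVtx d) := propext Sum.inl.inj_iff
  have h2 : (vl v = tVtx (d+1)) = (v = tVtx d) := propext Sum.inl.inj_iff
  simp only [h1, h2]

theorem ind_inr (d : ℕ) (p : Edg d × Bool) :
    ((if vr p = sVtx (d+1) then (1:ℝ) else 0)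
      - (if vr p = tVtx (d+1) then 1 else 0)) = 0 := by
  have h1 : (vr p = sVtx (d+1)) = False :=
    eq_false (fun h => Sum.inr_ne_inl h)
  have h2 : (vr p = tVtx (d+1)) = False :=
    eq_false (fun h => Sum.inr_ne_inl h)
  simp only [h1, h2, if_false, sub_zero]

theorem isFlow_succ (d : ℕ) (g : Edg (d+1) → ℝ) :
    IsFlow (d+1) g ↔ (∀ e b, g (e, b, true) = g (e, b, false)) ∧
      IsFlow d (fun e => g (e, false, false) + g (e, true, false)) := by
  constructor
  · intro h
    have hc : ∀ e b, g (e, b, true) = g (e, b, false) := by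
      intro e b
      have := h (vr (e, b))
      rw [flow_inr, ind_inr] at this
      linarith
    refine ⟨hc, fun v => ?_⟩
    have := h (vl v)
    rw [flow_inl, ind_inl] at this
    rw [← this]
    refine Finset.sum_congr rfl fun e _ => ?_
    rw [hc, hc]
    ring
  · rintro ⟨hc, hf⟩ v
    rcases v with v | ⟨e, b⟩
    · refine (flow_inl d g v).trans (Eq.trans ?_ (ind_inl d v).symm)
      rw [← hf v]
      refine Finset.sum_congr rfl fun e _ => ?_
      rw [hc, hc]
      ring
    · refine (flow_inr d g e b).trans (Eq.trans ?_ (ind_inr d (e, b)).symm)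
      rw [hc, sub_self]

theorem split_exists (k0 k1 : ℝ) (h0 : 0 ≤ k0) (h1 : 0 ≤ k1) :
    ∃ K a b : ℝ, 0 ≤ K ∧ 0 ≤ a ∧ 0 ≤ b ∧ a + b = 1 ∧ k0 * a^2 + k1 * b^2 = K ∧
      ∀ y z : ℝ, K * (y + z)^2 ≤ k0 * y^2 + k1 * z^2 := by
  rcases eq_or_lt_of_le (add_nonneg h0 h1) with h | h
  · have e0 : k0 = 0 := by linarith
    have e1 : k1 = 0 := by linarith
    subst e0 e1
    exact ⟨0, 1, 0, le_rfl, zero_le_one, le_rfl, by norm_num, by norm_num,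
      fun y z => by norm_num⟩
  · refine ⟨k0 * k1 / (k0 + k1), k1 / (k0 + k1), k0 / (k0 + k1), by positivity, by positivity,
      by positivity, by field_simp; ring, by field_simp; ring, fun y z => ?_⟩
    rw [div_mul_eq_mul_div, div_le_iff₀ h]
    nlinarith [sq_nonneg (k0 * y - k1 * z)]

theorem exists_opt : ∀ (d : ℕ) (r : Edg d → ℝ), (∀ e, 0 ≤ r e) →
    ∃ f : Edg d → ℝ, IsFlow d f ∧ ∑ e, (f e)^2 ≤ 2^d ∧
      ∀ g, IsFlow d g → ∑ e, r e * (f e)^2 ≤ ∑ e, r e * (g e)^2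
  | 0, r, hr => by
    have hs : ∀ F : Edg 0 → ℝ, ∑ e, F e = F () := fun F =>
      (by simp : ∀ G : Unit → ℝ, ∑ e, G e = G ()) F
    refine ⟨fun _ => 1, ?_, ?_, ?_⟩
    · intro v
      rw [hs, one_mul]
      have h1 : (ep 0 () false = v) = (v = sVtx 0) := propext eq_comm
      have h2 : (ep 0 () true = v) = (v = tVtx 0) := propext eq_comm
      simp only [h1, h2]
    · rw [hs]; norm_num
    · intro g hg
      have h := hg (sVtx 0)
      rw [hs] at h
      have h1 : (ep 0 () false = sVtx 0) = True := eq_true rfl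
      have h2 : (ep 0 () true = sVtx 0) = False := eq_false Bool.noConfusion
      have h3 : (sVtx 0 = tVtx 0) = False := eq_false Bool.noConfusion
      simp only [h1, h2, h3, if_true, if_false, sub_zero, mul_one] at h
      rw [hs, hs, h]
  | d+1, r, hr => by
    have hk : ∀ e : Edg d, _ := fun e =>
      split_exists (r (e, false, false) + r (e, false, true))
        (r (e, true, false) + r (e, true, true))
        (add_nonneg (hr _) (hr _)) (add_nonneg (hr _) (hr _))
    choose K a b hK ha hb hab hKe hmin using hk
    obtain ⟨f, hf, hf2, hfm⟩ := exists_opt d K hK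
    let g : Edg (d+1) → ℝ := fun p => (if p.2.1 then b p.1 else a p.1) * f p.1
    have g0 : ∀ e c, g (e, false, c) = a e * f e := fun e c => rfl
    have g1 : ∀ e c, g (e, true, c) = b e * f e := fun e c => rfl
    refine ⟨g, ?_, ?_, ?_⟩
    · rw [isFlow_succ]
      refine ⟨fun e b => rfl, ?_⟩
      have : (fun e => g (e, false, false) + g (e, true, false)) = f := by
        funext e
        rw [g0, g1, ← add_mul, hab, one_mul]
      rw [this]
      exact hf
    · rw [sum_edg_succ_s16]
      calc _ ≤ ∑ e, 2 * (f e)^2 := by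
            refine Finset.sum_le_sum fun e _ => ?_
            simp only [g0, g1]
            have h : (a e)^2 + (b e)^2 ≤ 1 := by
              nlinarith [mul_nonneg (ha e) (hb e), hab e]
            nlinarith [mul_le_mul_of_nonneg_right h (sq_nonneg (f e))]
        _ ≤ 2^(d+1) := by
            rw [← Finset.mul_sum, pow_succ]; linarith
    · intro g' hg'
      obtain ⟨hc, hf'⟩ := (isFlow_succ d g').1 hg'
      rw [sum_edg_succ_s16, sum_edg_succ_s16]
      calc _ = ∑ e, K e * (f e)^2 := by
            refine Finset.sum_congr rfl fun e _ => ?_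
            simp only [g0, g1]
            rw [← hKe e]
            ring
        _ ≤ _ := hfm _ hf'
        _ ≤ _ := by
            refine Finset.sum_le_sum fun e _ => (hmin e _ _).trans (le_of_eq ?_)
            rw [hc, hc]
            ring

theorem sum_dir (d : ℕ) (F : Edg d × Bool → ℝ) :
    ∑ p, F p = ∑ e, (F (e, false) + F (e, true)) := by
  rw [Fintype.sum_prod_type]
  refine Finset.sum_congr rfl fun e _ => ?_
  rw [Fintype.sum_bool, add_comm]

theorem isTau_iff (d : ℕ) (w : Edg d × Bool → ℝ) :
    IsTauWitness d w ↔ IsFlow d (fun e => w (e, false) - w (e, true)) := by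
  refine forall_congr' fun v => ?_
  rw [sum_dir]
  refine Eq.congr_left (Finset.sum_congr rfl fun e _ => ?_)
  simp only [Bool.not_false, Bool.not_true]
  ring

/-- `w̃₊(x, P_{G_d}) ≤ 2^(d+1)`. -/
theorem approxPosWit_le (d : ℕ) (x : Fin (2^(2*d)) → Bool) :
    approxPosWit d x ≤ 2^(d+1) := by
  obtain ⟨f, hf, hf2, hmin⟩ := exists_opt d (fun e => if edgeBit d x e = true then (0:ℝ) else 1)
    (fun e => by split_ifs <;> norm_num)
  let w : Edg d × Bool → ℝ := fun p => if p.2 then - (f p.1 / 2) else f p.1 / 2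
  have w0 : ∀ e, w (e, false) = f e / 2 := fun e => rfl
  have w1 : ∀ e, w (e, true) = - (f e / 2) := fun e => rfl
  have hw : IsTauWitness d w := by
    rw [isTau_iff]
    have : (fun e => w (e, false) - w (e, true)) = f := by
      funext e
      rw [w0, w1]; ring
    rw [this]; exact hf
  have key : ∀ w', IsTauWitness d w' →
      (∑ p : Edg d × Bool, (if edgeBit d x p.1 = true then 0 else (w p)^2)) ≤
      ∑ p : Edg d × Bool, (if edgeBit d x p.1 = true then 0 else (w' p)^2) := by
    intro w' hw'
    have h := hmin _ ((isTau_iff d w').1 hw')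
    rw [sum_dir, sum_dir]
    have h2 := mul_le_mul_of_nonneg_left h (by norm_num : (0:ℝ) ≤ 1/2)
    rw [Finset.mul_sum, Finset.mul_sum] at h2
    refine (le_of_eq ?_).trans (h2.trans ?_)
    · refine Finset.sum_congr rfl fun e _ => ?_
      simp only [w0, w1]
      split_ifs <;> ring
    · refine Finset.sum_le_sum fun e _ => ?_
      dsimp only
      split_ifs
      · norm_num
      · nlinarith [sq_nonneg (w' (e, false) + w' (e, true))]
  have herr : (∑ p : Edg d × Bool, (if edgeBit d x p.1 = true then 0 else (w p)^2))
      = posErr d x := by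
    unfold posErr
    refine Eq.symm (IsLeast.csInf_eq ⟨⟨w, hw, rfl⟩, ?_⟩)
    rintro _ ⟨w', hw', rfl⟩
    exact key w' hw'
  unfold approxPosWit
  refine le_trans (csInf_le ⟨0, ?_⟩ ⟨w, hw, herr, rfl⟩) ?_
  · rintro _ ⟨w', _, _, rfl⟩
    exact Finset.sum_nonneg fun p _ => sq_nonneg _
  · rw [sum_dir]
    calc _ ≤ ∑ e, (f e)^2 := by
          refine Finset.sum_le_sum fun e _ => ?_
          rw [w0, w1]
          nlinarith [sq_nonneg (f e)]
      _ ≤ 2^d := hf2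
      _ ≤ 2^(d+1) := pow_le_pow_right₀ one_le_two (Nat.le_succ d)

end NandTree
end
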